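/- The fullerene nanodisc D_3 (with its twelve pentagons arranged in six consecutive pairs) admits a proper 4-total coloring; hence, being 3-regular, its total chromatic number is 4 = Δ(D_3) + 1, i.e., D_3 is Type 1. -/

import Mathlib

/-- A proper total coloring of `G`: `cv` colors the vertices, `ce` colors the edges
(as unordered pairs); adjacent vertices get different colors, an edge gets a color
different from both of its endpoints, and edges sharing an endpoint get different colors. -/
def IsTotalColoring {V C : Type*} (G : SimpleGraph V) (cv : V → C) (ce : Sym2 V → C) : Prop :=
  (∀ ⦃u v : V⦄, G.Adj u v → cv u ≠ cv v) ∧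
  (∀ ⦃u v : V⦄, G.Adj u v → ce s(u, v) ≠ cv u) ∧
  (∀ ⦃u v w : V⦄, G.Adj u v → G.Adj u w → v ≠ w → ce s(u, v) ≠ ce s(u, w))

/-- The total chromatic number: the least `k` such that `G` has a proper total
coloring with a set of `k` colors. -/
noncomputable def totalChromaticNumber {V : Type*} (G : SimpleGraph V) : ℕ :=
  sInf {k : ℕ | ∃ (cv : V → Fin k) (ce : Sym2 V → Fin k), IsTotalColoring G cv ce}

/-- The vertices of the fullerene nanodisc `D_3` (with pentagons in pairs): the
outer 6-cycle `O`, the 18-cycle `A`, the two central 30-cycles `B` and `Bp` (= B′),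
the 18-cycle `Ap` (= A′), and the inner 6-cycle `I`. -/
inductive D3V
  | O : ZMod 6 → D3V
  | A : ZMod 18 → D3V
  | B : ZMod 30 → D3V
  | Bp : ZMod 30 → D3V
  | Ap : ZMod 18 → D3V
  | I : ZMod 6 → D3V
  deriving DecidableEq, Fintype

/-- The 12 radial edges between an 18-cycle and a 30-cycle of `D_3`, pairing in
increasing cyclic order the vertices `k` with `k ≢ 0 (mod 3)` with the vertices `m`
with `m mod 5 ∈ {0, 3}`. -/
def d3ABRel (k : ZMod 18) (m : ZMod 30) : Bool :=
  (k == 1 && m == 0) || (k == 2 && m == 3) || (k == 4 && m == 5) || (k == 5 && m == 8) ||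
  (k == 7 && m == 10) || (k == 8 && m == 13) || (k == 10 && m == 15) || (k == 11 && m == 18) ||
  (k == 13 && m == 20) || (k == 14 && m == 23) || (k == 16 && m == 25) || (k == 17 && m == 28)

open D3V in
/-- The adjacency generating relation of `D_3` (with pentagons in pairs): the six
cycles, the outer radial edges `O_i — A_{3i}`, the inner radial edges `I_i — A′_{3i}`,
the 12 radial edges between `A` and `B` and the 12 radial edges between `A′` and `B′`
(following the identical pattern), and the 18 central radial edges `B_k — B′_{k+3}`
for `k mod 5 ∈ {1, 4}` and `B_k — B′_{k+4}` for `k mod 5 = 2`. -/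
def d3Rel : D3V → D3V → Bool
  | O i, O j => j == i + 1
  | A k, A l => l == k + 1
  | B m, B l => l == m + 1
  | Bp m, Bp l => l == m + 1
  | Ap k, Ap l => l == k + 1
  | I i, I j => j == i + 1
  | O i, A k => k == (3 * i.val : ZMod 18)
  | I i, Ap k => k == (3 * i.val : ZMod 18)
  | A k, B m => d3ABRel k m
  | Ap k, Bp m => d3ABRel k m
  | B k, Bp l => ((k.val % 5 == 1 || k.val % 5 == 4) && l == k + 3) ||
      (k.val % 5 == 2 && l == k + 4)
  | _, _ => false

/-- The fullerene nanodisc `D_3` with its twelve pentagons arranged in six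
consecutive pairs. -/
def D3 : SimpleGraph D3V := SimpleGraph.fromRel (fun a b => d3Rel a b = true)

instance : DecidableRel D3.Adj := fun a b =>
  decidable_of_iff _ (SimpleGraph.fromRel_adj _ a b).symm

/-- The three neighbors of a vertex of `D_3`. -/
def d3Neighbors : D3V → List D3V
  | .O i => [.O (i + 1), .O (i - 1), .A (3 * i.val : ZMod 18)]
  | .A k => [.A (k + 1), .A (k - 1),
      match k.val % 3 with
      | 0 => .O (k.val / 3 : ℕ)
      | 1 => .B (5 * (k.val / 3) : ℕ)
      | _ => .B (5 * (k.val / 3) + 3 : ℕ)]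
  | .B m => [.B (m + 1), .B (m - 1),
      match m.val % 5 with
      | 0 => .A (3 * (m.val / 5) + 1 : ℕ)
      | 3 => .A (3 * (m.val / 5) + 2 : ℕ)
      | 2 => .Bp (m + 4)
      | _ => .Bp (m + 3)]
  | .Bp m => [.Bp (m + 1), .Bp (m - 1),
      match m.val % 5 with
      | 0 => .Ap (3 * (m.val / 5) + 1 : ℕ)
      | 3 => .Ap (3 * (m.val / 5) + 2 : ℕ)
      | 1 => .B (m - 4)
      | _ => .B (m - 3)]
  | .Ap k => [.Ap (k + 1), .Ap (k - 1),
      match k.val % 3 with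
      | 0 => .I (k.val / 3 : ℕ)
      | 1 => .Bp (5 * (k.val / 3) : ℕ)
      | _ => .Bp (5 * (k.val / 3) + 3 : ℕ)]
  | .I i => [.I (i + 1), .I (i - 1), .Ap (3 * i.val : ZMod 18)]

/-- The `n`-th power of the color permutation `(0 1 2)`, which fixes the color `3`. -/
def twistColor (n : ℕ) (c : Fin 4) : Fin 4 :=
  if c = 3 then 3 else Fin.ofNat 4 ((c.val + n) % 3)

/-- A vertex coloring of `D_3` for which the rotation by one sixth of a turn acts on the
colors as the permutation `(0 1 2)`. -/
def d3VertexColor : D3V → Fin 4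
  | .O i => twistColor i.val 0
  | .A k => twistColor (k.val / 3) (![1, 2, 1] (Fin.ofNat 3 k.val))
  | .B m => twistColor (m.val / 5) (![3, 1, 2, 3, 2] (Fin.ofNat 5 m.val))
  | .Bp m => twistColor (m.val / 5) (![3, 2, 0, 3, 0] (Fin.ofNat 5 m.val))
  | .Ap k => twistColor (k.val / 3) (![2, 0, 2] (Fin.ofNat 3 k.val))
  | .I i => twistColor i.val 1

/-- The color of the edge `u — v` when `d3Rel u v` holds, equivariant under the rotation
in the same way as `d3VertexColor`; it is `0` when `d3Rel u v` fails. -/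
def d3ArcColor (u v : D3V) : Fin 4 :=
  if d3Rel u v then
    match u, v with
    | .O i, .O _ => twistColor i.val 2
    | .A k, .A _ => twistColor (k.val / 3) (![0, 3, 0] (Fin.ofNat 3 k.val))
    | .B m, .B _ => twistColor (m.val / 5) (![2, 0, 1, 0, 1] (Fin.ofNat 5 m.val))
    | .Bp m, .Bp _ => twistColor (m.val / 5) (![0, 1, 2, 1, 2] (Fin.ofNat 5 m.val))
    | .Ap k, .Ap _ => twistColor (k.val / 3) (![1, 3, 1] (Fin.ofNat 3 k.val))
    | .I i, .I _ => twistColor i.val 0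
    | .A k, .B _ => twistColor (k.val / 3) (![0, 1, 2] (Fin.ofNat 3 k.val))
    | .Ap k, .Bp _ => twistColor (k.val / 3) (![1, 2, 0] (Fin.ofNat 3 k.val))
    | _, _ => 3
  else 0

/-- The edge coloring of `D_3` induced by `d3ArcColor`. -/
def d3EdgeColor : Sym2 D3V → Fin 4 :=
  Sym2.lift ⟨fun u v => max (d3ArcColor u v) (d3ArcColor v u), fun _ _ => max_comm _ _⟩

theorem D3_adj_iff_mem_d3Neighbors (u v : D3V) : D3.Adj u v ↔ v ∈ d3Neighbors u := by
  rw [D3, SimpleGraph.fromRel_adj]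
  cases u <;> cases v <;> rename_i i j <;> revert i j <;> decide +kernel

theorem d3Neighbors_nodup (u : D3V) : (d3Neighbors u).Nodup := by
  have h6 : ∀ i : ZMod 6, i + 1 ≠ i - 1 := by decide
  have h18 : ∀ k : ZMod 18, k + 1 ≠ k - 1 := by decide
  have h30 : ∀ m : ZMod 30, m + 1 ≠ m - 1 := by decide
  cases u <;> simp only [d3Neighbors] <;> (try split) <;> simp [h6, h18, h30]

theorem length_d3Neighbors (u : D3V) : (d3Neighbors u).length = 3 := by
  cases u <;> rfl

theorem D3_degree (v : D3V) : D3.degree v = 3 := by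
  have h : D3.neighborFinset v = (d3Neighbors v).toFinset := by
    ext w
    rw [SimpleGraph.mem_neighborFinset, List.mem_toFinset, D3_adj_iff_mem_d3Neighbors]
  rw [SimpleGraph.degree, h, List.toFinset_card_of_nodup (d3Neighbors_nodup v),
    length_d3Neighbors]

theorem D3_isTotalColoring : IsTotalColoring D3 d3VertexColor d3EdgeColor := by
  have hv : ∀ u, ∀ v ∈ d3Neighbors u, d3VertexColor u ≠ d3VertexColor v := by
    intro u
    cases u <;> rename_i i <;> revert i <;> decide +kernel
  have he : ∀ u, ∀ v ∈ d3Neighbors u, d3EdgeColor s(u, v) ≠ d3VertexColor u := by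
    intro u
    cases u <;> rename_i i <;> revert i <;> decide +kernel
  have hee : ∀ u, ((d3Neighbors u).map fun v => d3EdgeColor s(u, v)).Nodup := by
    intro u
    cases u <;> rename_i i <;> revert i <;> decide +kernel
  simp only [IsTotalColoring, D3_adj_iff_mem_d3Neighbors]
  exact ⟨hv, he, fun u v w hv hw => mt (List.inj_on_of_nodup_map (hee u) hv hw)⟩

/-- The colors of a vertex and of the edges at it are pairwise distinct, so a total coloring
uses more colors than the degree of any vertex. -/
theorem IsTotalColoring.degree_lt {V : Type*} {G : SimpleGraph V} {k : ℕ} {cv : V → Fin k}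
    {ce : Sym2 V → Fin k} (h : IsTotalColoring G cv ce) (v : V) [Fintype (G.neighborSet v)] :
    G.degree v < k := by
  have hinj : Set.InjOn (fun w => ce s(v, w)) (G.neighborFinset v) := by
    intro u hu w hw huw
    rw [Finset.mem_coe, SimpleGraph.mem_neighborFinset] at hu hw
    by_contra hne
    exact h.2.2 hu hw hne huw
  have hcv : cv v ∉ (G.neighborFinset v).image (fun w => ce s(v, w)) := by
    simpa using fun w hw => h.2.1 hw
  have hcard := Finset.card_lt_univ_of_notMem hcv
  rwa [Finset.card_image_of_injOn hinj, Fintype.card_fin] at hcard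

theorem D3_type1 :
    (∃ (cv : D3V → Fin 4) (ce : Sym2 D3V → Fin 4), IsTotalColoring D3 cv ce) ∧
    (∀ v : D3V, D3.degree v = 3) ∧
    D3.maxDegree = 3 ∧ totalChromaticNumber D3 = D3.maxDegree + 1 := by
  have hmax : D3.maxDegree = 3 :=
    le_antisymm (D3.maxDegree_le_of_forall_degree_le 3 fun v => (D3_degree v).le)
      ((D3_degree (.O 0)).symm.trans_le (D3.degree_le_maxDegree _))
  have hcol : ∃ (cv : D3V → Fin 4) (ce : Sym2 D3V → Fin 4), IsTotalColoring D3 cv ce :=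
    ⟨_, _, D3_isTotalColoring⟩
  refine ⟨hcol, D3_degree, hmax, ?_⟩
  rw [hmax]
  refine le_antisymm (Nat.sInf_le hcol) (le_csInf ⟨4, hcol⟩ ?_)
  rintro k ⟨cv, ce, h⟩
  exact (D3_degree (.O 0)).symm.trans_lt (h.degree_lt _)
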